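/- arXiv:2207.04120 — 2 statements merged into one kernel-verified Lean document; each statement's English description precedes it below -/
import Mathlib

section
/- Let K be a field of characteristic zero and let M be a frieze matrix of size n ≥ 2 over K. Then M is row equivalent to T_M: there exists an invertible matrix E ∈ K^{n×n} with det(E) = −1 such that E·M = T_M. -/
/-- A frieze matrix of size `n` over a field `K`, represented as a function on
1-based indices `1,…,n`. -/
def IsFriezeMatrix {K : Type*} [Field K] (n : ℕ) (m : ℕ → ℕ → K) : Prop :=
  (∀ i j, 1 ≤ i → i ≤ n → 1 ≤ j → j ≤ n → m i j = m j i) ∧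
  (∀ i j, 1 ≤ i → i ≤ n → 1 ≤ j → j ≤ n → (m i j = 0 ↔ i = j)) ∧
  (∀ i j, 1 ≤ i → i + 1 ≤ j → j + 1 ≤ n →
    m i j * m (i + 1) (j + 1) - m (i + 1) j * m i (j + 1) = m i (i + 1) * m j (j + 1))

/-- The triangulated form `T_M` of a frieze matrix `M = (m i j)`, on 1-based indices:
`t 1 j = m 2 j`, `t 2 j = m 1 j`, and for `i ≥ 3`: `t i j = 0` if `j < i` and
`t i j = (-2 * m 1 j / m 1 (i-1)) * m (i-1) i` if `j ≥ i`. -/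
def friezeT {K : Type*} [Field K] (m : ℕ → ℕ → K) (i j : ℕ) : K :=
  if i = 1 then m 2 j
  else if i = 2 then m 1 j
  else if j < i then 0
  else (-2 * m 1 j / m 1 (i - 1)) * m (i - 1) i

namespace IsFriezeMatrix

variable {K : Type*} [Field K] {n : ℕ} {m : ℕ → ℕ → K}

theorem apply_self (hM : IsFriezeMatrix n m) {i : ℕ} (hi : 1 ≤ i) (hin : i ≤ n) : m i i = 0 :=
  (hM.2.1 i i hi hin hi hin).2 rfl

theorem apply_ne_zero (hM : IsFriezeMatrix n m) {i j : ℕ} (hi : 1 ≤ i) (hij : i < j)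
    (hjn : j ≤ n) : m i j ≠ 0 := fun h =>
  hij.ne ((hM.2.1 i j hi (by omega) (by omega) hjn).1 h)

/-- The three-term recurrence between consecutive columns. -/
theorem three_term (hM : IsFriezeMatrix n m) {i k : ℕ} (hi : 1 ≤ i) (hik : i ≤ k)
    (hk : k + 2 ≤ n) :
    m (k + 1) (k + 2) * m i k + m k (k + 1) * m i (k + 2) = m k (k + 2) * m i (k + 1) := by
  obtain ⟨t, rfl⟩ := Nat.exists_eq_add_of_le hik
  clear hik
  induction t generalizing i with
  | zero =>
    rw [add_zero, hM.apply_self hi (by omega)]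
    ring
  | succ t ih =>
    have h := ih (i := i + 1) (by omega) (by omega)
    rw [show i + 1 + t = i + (t + 1) by omega] at h
    have h₁ := hM.2.2 i (i + (t + 1)) hi (by omega) (by omega)
    have h₂ := hM.2.2 i (i + (t + 1) + 1) hi (by omega) (by omega)
    refine mul_left_cancel₀
      (hM.apply_ne_zero (i := i + 1) (j := i + (t + 1) + 1) (by omega) (by omega) (by omega)) ?_
    linear_combination m (i + (t + 1) + 1) (i + (t + 1) + 2) * h₁ -
      m (i + (t + 1)) (i + (t + 1) + 1) * h₂ + m i (i + (t + 1) + 1) * h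

/-- The Ptolemy relation for indices `i ≤ j ≤ k < k + 1`. -/
theorem ptolemy_right (hM : IsFriezeMatrix n m) {i j k : ℕ} (hi : 1 ≤ i) (hij : i ≤ j)
    (hjk : j ≤ k) (hk : k + 1 ≤ n) :
    m i k * m j (k + 1) = m i j * m k (k + 1) + m i (k + 1) * m j k := by
  induction k, hjk using Nat.le_induction with
  | base =>
    rw [hM.apply_self (i := j) (by omega) (by omega)]
    ring
  | succ k hjk ih =>
    have h := ih (by omega)
    have h₁ := hM.three_term (i := i) (k := k) hi (by omega) (by omega)
    have h₂ := hM.three_term (i := j) (k := k) (by omega) hjk (by omega)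
    refine mul_left_cancel₀ (hM.apply_ne_zero (i := k) (j := k + 1) (by omega) (by omega)
      (by omega)) ?_
    linear_combination m i (k + 1) * h₂ - m j (k + 1) * h₁ + m (k + 1) (k + 2) * h

/-- The Ptolemy relation for indices `i ≤ k < k + 1 ≤ j`. -/
theorem ptolemy_mid (hM : IsFriezeMatrix n m) {i j k : ℕ} (hi : 1 ≤ i) (hik : i ≤ k)
    (hkj : k + 1 ≤ j) (hj : j ≤ n) :
    m i (k + 1) * m k j = m i k * m (k + 1) j + m i j * m k (k + 1) := by
  induction j using Nat.strong_induction_on with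
  | _ j ih =>
    obtain rfl | rfl | h : j = k + 1 ∨ j = k + 2 ∨ k + 3 ≤ j := by omega
    · rw [hM.apply_self (i := k + 1) (by omega) (by omega)]
      ring
    · linear_combination -hM.three_term hi hik hj
    · obtain ⟨l, rfl⟩ : ∃ l, j = l + 2 := ⟨j - 2, by omega⟩
      have e₁ := ih (l + 1) (by omega) (by omega) (by omega)
      have e₀ := ih l (by omega) (by omega) (by omega)
      have hi' := hM.three_term (i := i) (k := l) hi (by omega) hj
      have hk₀ := hM.three_term (i := k) (k := l) (by omega) (by omega) hj
      have hk₁ := hM.three_term (i := k + 1) (k := l) (by omega) (by omega) hj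
      refine mul_left_cancel₀ (hM.apply_ne_zero (i := l) (j := l + 1) (by omega) (by omega)
        (by omega)) ?_
      linear_combination m i (k + 1) * hk₀ - m i k * hk₁ - m k (k + 1) * hi' +
        m l (l + 2) * e₁ - m (l + 1) (l + 2) * e₀

theorem friezeT_eq [CharZero K] (hM : IsFriezeMatrix n m) {i j : ℕ} (hi : 2 ≤ i)
    (hin : i + 1 ≤ n) (hj : 1 ≤ j) (hjn : j ≤ n) :
    m (i + 1) j - (m 1 (i + 1) / m 1 i * m i j + m i (i + 1) / m 1 i * m 1 j) =
      friezeT m (i + 1) j := by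
  have h0 : m 1 i ≠ 0 := hM.apply_ne_zero le_rfl (by omega) (by omega)
  rw [friezeT, if_neg (by omega), if_neg (by omega), Nat.add_sub_cancel]
  split_ifs with h
  · have e := hM.ptolemy_right (i := 1) (j := j) (k := i) le_rfl hj (by omega) hin
    rw [hM.1 (i + 1) j (by omega) hin hj hjn, hM.1 i j (by omega) (by omega) hj hjn]
    field_simp
    linear_combination e
  · have e := hM.ptolemy_mid (i := 1) (j := j) (k := i) le_rfl (by omega) (by omega) hjn
    field_simp
    linear_combination -e

end IsFriezeMatrix

/-- The unipotent lower triangular factor of the row reduction of a frieze matrix: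
it fixes the first two rows and combines every later row with the preceding and first ones. -/
def friezeL {K : Type*} [Field K] {n : ℕ} (m : ℕ → ℕ → K) : Matrix (Fin n) (Fin n) K :=
  Matrix.of fun i => Pi.single i 1 -
    if 2 ≤ i.1 then
      (m 1 (i.1 + 1) / m 1 i.1) • Pi.single (⟨i.1 - 1, by omega⟩ : Fin n) (1 : K) +
      (m i.1 (i.1 + 1) / m 1 i.1) • Pi.single (⟨0, i.pos⟩ : Fin n) (1 : K)
    else 0

theorem det_friezeL {K : Type*} [Field K] {n : ℕ} (m : ℕ → ℕ → K) :
    (friezeL m : Matrix (Fin n) (Fin n) K).det = 1 := by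
  rw [Matrix.det_of_isLowerTriangular]
  · refine Finset.prod_eq_one fun i _ => ?_
    by_cases h : 2 ≤ i.1
    · have h₁ : i ≠ ⟨i.1 - 1, by omega⟩ := fun e => by have := congrArg Fin.val e; grind
      have h₂ : i ≠ ⟨0, i.pos⟩ := fun e => by have := congrArg Fin.val e; grind
      simp [friezeL, h, Pi.single_eq_of_ne h₁, Pi.single_eq_of_ne h₂]
    · simp [friezeL, h]
  · intro i j hij
    have hij : i < j := hij
    have h₀ : j ≠ i := hij.ne'
    have h₁ : j ≠ ⟨i.1 - 1, by omega⟩ := fun e => by have := congrArg Fin.val e; grind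
    have h₂ : j ≠ ⟨0, i.pos⟩ := fun e => by have := congrArg Fin.val e; grind
    by_cases h : 2 ≤ i.1 <;>
      simp [friezeL, h, Pi.single_eq_of_ne h₀, Pi.single_eq_of_ne h₁, Pi.single_eq_of_ne h₂]

theorem friezeL_mul_apply {K : Type*} [Field K] {n : ℕ} (m : ℕ → ℕ → K)
    (M : Matrix (Fin n) (Fin n) K) (i j : Fin n) :
    ((friezeL m : Matrix (Fin n) (Fin n) K) * M) i j = M i j -
      if 2 ≤ i.1 then
        m 1 (i.1 + 1) / m 1 i.1 * M ⟨i.1 - 1, by omega⟩ j +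
        m i.1 (i.1 + 1) / m 1 i.1 * M ⟨0, i.pos⟩ j
      else 0 := by
  rw [Matrix.mul_apply_eq_vecMul]
  unfold friezeL
  rw [show ∀ f : Fin n → Fin n → K, Matrix.of f i = f i from fun _ => rfl]
  by_cases h : 2 ≤ i.1 <;>
    simp [h, Matrix.sub_vecMul, Matrix.add_vecMul, Matrix.smul_vecMul]

/-- Proposition 4, first part: a frieze matrix `M` of size `n ≥ 2` is row equivalent to
its triangulated form `T_M`: there is an invertible matrix `E` with `det E = -1`
such that `E * M = T_M`. -/
theorem friezeMatrix_rowEquiv_triangulated {K : Type*} [Field K] [CharZero K]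
    (n : ℕ) (hn : 2 ≤ n) (m : ℕ → ℕ → K) (hM : IsFriezeMatrix n m) :
    ∃ E : Matrix (Fin n) (Fin n) K, IsUnit E ∧ E.det = -1 ∧
      E * Matrix.of (fun i j : Fin n => m (i.1 + 1) (j.1 + 1)) =
        Matrix.of (fun i j : Fin n => friezeT m (i.1 + 1) (j.1 + 1)) := by
  let a : Fin n := ⟨0, by omega⟩
  let b : Fin n := ⟨1, by omega⟩
  have hab : a ≠ b := by simp [a, b]
  have hdet : ((friezeL m : Matrix (Fin n) (Fin n) K).submatrix (Equiv.swap a b) id).det = -1 := by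
    rw [Matrix.det_permute, det_friezeL, Equiv.Perm.sign_swap hab]
    simp
  refine ⟨(friezeL m).submatrix (Equiv.swap a b) id, ?_, hdet, ?_⟩
  · rw [Matrix.isUnit_iff_isUnit_det, hdet]
    exact isUnit_one.neg
  · ext i j
    change ((friezeL m : Matrix (Fin n) (Fin n) K) *
      (Matrix.of fun i j : Fin n => m (i.1 + 1) (j.1 + 1)) : Matrix (Fin n) (Fin n) K)
      (Equiv.swap a b i) j = _
    rw [friezeL_mul_apply]
    by_cases ha : i = a
    · subst ha
      simp [a, b, friezeT]
    by_cases hb : i = b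
    · subst hb
      simp [a, b, friezeT]
    have hi : 2 ≤ i.1 := by
      have h₀ : i.1 ≠ 0 := fun h => ha (Fin.ext h)
      have h₁ : i.1 ≠ 1 := fun h => hb (Fin.ext h)
      omega
    rw [Equiv.swap_apply_of_ne_of_ne ha hb, if_pos hi]
    simp only [Matrix.of_apply, Nat.sub_add_cancel (by omega : 1 ≤ i.1)]
    exact hM.friezeT_eq hi (by omega) (by omega) (by omega)
end

section
/- Let K be a field of characteristic zero and let M = (m_{i,j}) be a frieze matrix of size n ≥ 2 over K. Then det(M) = −(−2)^{n−2} · m_{1,n} · ∏_{i=1}^{n−1} m_{i,i+1}. -/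
/-- The leading `n × n` block of `f`, with its last column replaced by `c`. -/
def borderedBlock {K : Type*} (f : ℕ → ℕ → K) (c : ℕ → K) (n : ℕ) : Matrix (Fin n) (Fin n) K :=
  Matrix.of fun i j => if j.1 + 1 = n then c i else f i j

/-- If the last row is, up to the scalar `r` and except in the next to last column, a combination
of the two previous rows, then the determinant reduces to that of the next smaller block. -/
theorem mul_det_borderedBlock {K : Type*} [Field K] (f : ℕ → ℕ → K) (c : ℕ → K) (k : ℕ)
    (r s t : K)
    (hrow : ∀ j ≤ k, r * f (k + 2) j = s * f (k + 1) j + t * f k j)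
    (hcol : r * c (k + 2) = s * c (k + 1) + t * c k) :
    r * (borderedBlock f c (k + 3)).det =
      -(r * f (k + 2) (k + 1) - s * f (k + 1) (k + 1) - t * f k (k + 1)) *
        (borderedBlock f c (k + 2)).det := by
  set A := borderedBlock f c (k + 3) with hA
  let l : Fin (k + 3) := Fin.last (k + 2)
  let p : Fin (k + 3) := ⟨k + 1, by omega⟩
  let q : Fin (k + 3) := ⟨k, by omega⟩
  have hpl : p ≠ l := by simp [p, l, Fin.ext_iff]
  have hql : q ≠ l := by simp [q, l, Fin.ext_iff]
  have hdet : (A.updateRow l (r • A l + (-s) • A p + (-t) • A q)).det = r * A.det := by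
    have hp : (A.updateRow l (A p)).det = 0 :=
      Matrix.det_zero_of_row_eq hpl (by simp [Matrix.updateRow_ne hpl])
    have hq : (A.updateRow l (A q)).det = 0 :=
      Matrix.det_zero_of_row_eq hql (by simp [Matrix.updateRow_ne hql])
    rw [Matrix.det_updateRow_add, Matrix.det_updateRow_add, Matrix.det_updateRow_smul,
      Matrix.det_updateRow_smul, Matrix.det_updateRow_smul, Matrix.updateRow_eq_self, hp, hq]
    simp
  rw [← hdet, Matrix.det_succ_row _ l, Finset.sum_eq_single p]
  · have hminor : (A.updateRow l (r • A l + (-s) • A p + (-t) • A q)).submatrix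
        l.succAbove p.succAbove = borderedBlock f c (k + 2) := by
      ext i j
      have hi : l.succAbove i = i.castSucc := by simp [l]
      have hne : i.castSucc ≠ l := (Fin.castSucc_lt_last i).ne
      rw [Matrix.submatrix_apply, hi, Matrix.updateRow_ne hne]
      have hj : (p.succAbove j).1 = if j.1 < k + 1 then j.1 else j.1 + 1 := by
        simp only [Fin.succAbove, Fin.lt_def, p]
        split_ifs <;> simp_all
      have := j.2
      simp only [hA, borderedBlock, Matrix.of_apply, hj, Fin.val_castSucc]
      split_ifs <;> first | rfl | omega
    have hsign : (-1 : K) ^ ((l : ℕ) + (p : ℕ)) = -1 := by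
      apply Odd.neg_one_pow
      exact ⟨k + 1, by simp [l, p]; omega⟩
    rw [hminor, hsign, Matrix.updateRow_self]
    congr 1
    simp [hA, borderedBlock, l, p, q]
    ring
  · intro j _ hj
    rw [Matrix.updateRow_self]
    have hjp : j.1 ≠ k + 1 := fun h => hj (Fin.ext h)
    have hj3 := j.2
    rcases Nat.lt_or_ge k j.1 with h | h
    · have hj2 : j.1 = k + 2 := by omega
      simp [hA, borderedBlock, l, p, q, hj2, hcol]
    · have hj2 : j.1 ≠ k + 2 := by omega
      simp [hA, borderedBlock, l, p, q, hj2, hrow j h]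
  · simp

namespace IsFriezeMatrix

variable {K : Type*} [Field K] {n : ℕ} {m : ℕ → ℕ → K}

theorem diag_eq_zero (hM : IsFriezeMatrix n m) {i : ℕ} (h1 : 1 ≤ i) (hn : i ≤ n) :
    m i i = 0 :=
  (hM.2.1 i i h1 hn h1 hn).2 rfl

theorem ne_zero (hM : IsFriezeMatrix n m) {i j : ℕ} (h1 : 1 ≤ i) (hij : i < j) (hn : j ≤ n) :
    m i j ≠ 0 := fun h =>
  hij.ne ((hM.2.1 i j h1 (by omega) (by omega) hn).1 h)

/-- The Ptolemy relation for `j ≤ k < k + 1 < k + 2`. -/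
theorem ptolemy_left (hM : IsFriezeMatrix n m) {k : ℕ} (hk : k + 2 ≤ n) {j : ℕ}
    (h1 : 1 ≤ j) (hjk : j ≤ k) :
    m k (k + 1) * m j (k + 2) = m k (k + 2) * m j (k + 1) - m (k + 1) (k + 2) * m j k := by
  induction hjk using Nat.decreasingInduction with
  | self => rw [hM.diag_eq_zero h1 (by omega)]; ring
  | of_succ j hj ih =>
    have ih := ih (by omega)
    have e1 := hM.2.2 j k h1 (by omega) (by omega)
    have e2 := hM.2.2 j (k + 1) h1 (by omega) (by omega)
    have h0 := hM.ne_zero (i := j + 1) (j := k + 1) (by omega) (by omega) (by omega)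
    apply mul_left_cancel₀ h0
    linear_combination (-m k (k + 1)) * e2 + m (k + 1) (k + 2) * e1 + m j (k + 1) * ih

/-- The Ptolemy relation for `k < k + 1 < k + 2 ≤ l`. -/
theorem ptolemy_right_s3 (hM : IsFriezeMatrix n m) {k : ℕ} (h1 : 1 ≤ k) {l : ℕ}
    (hkl : k + 2 ≤ l) (hl : l ≤ n) :
    m k (k + 1) * m (k + 2) l = m k (k + 2) * m (k + 1) l - m (k + 1) (k + 2) * m k l := by
  induction l, hkl using Nat.le_induction with
  | base => rw [hM.diag_eq_zero (by omega) hl]; ring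
  | succ l hkl ih =>
    have ih := ih (by omega)
    have e1 := hM.2.2 k l h1 (by omega) hl
    have e2 := hM.2.2 (k + 1) l (by omega) (by omega) hl
    have h0 := hM.ne_zero (i := k + 1) (j := l) (by omega) (by omega) (by omega)
    apply mul_left_cancel₀ h0
    linear_combination m k (k + 1) * e2 - m (k + 1) (k + 2) * e1 + m (k + 1) (l + 1) * ih

/-- The determinant of a leading block whose last column is taken from column `n`. -/
theorem det_borderedBlock (hM : IsFriezeMatrix n m) (k : ℕ) (hk : k + 2 ≤ n) :
    (borderedBlock (fun i j => m (i + 1) (j + 1)) (fun i => m (i + 1) n) (k + 2)).det =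
      -(-2 : K) ^ k * m 1 n * ∏ i ∈ Finset.Icc 1 (k + 1), m i (i + 1) := by
  induction k with
  | zero =>
    rw [Matrix.det_fin_two]
    simp [borderedBlock, hM.diag_eq_zero le_rfl (by omega : 1 ≤ n),
      hM.1 2 1 (by omega) hk le_rfl (by omega)]
  | succ k ih =>
    have ih := ih (by omega)
    have h0 := hM.ne_zero (i := k + 1) (j := k + 2) (by omega) (by omega) (by omega)
    have h := mul_det_borderedBlock (fun i j => m (i + 1) (j + 1)) (fun i => m (i + 1) n) k
      (m (k + 1) (k + 2)) (m (k + 1) (k + 3)) (-m (k + 2) (k + 3))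
      (fun j hj => by
        have := hM.ptolemy_left (k := k + 1) (by omega) (j := j + 1) (by omega) (by omega)
        simp only [hM.1 (k + 2 + 1) (j + 1) (by omega) (by omega) (by omega) (by omega),
          hM.1 (k + 1 + 1) (j + 1) (by omega) (by omega) (by omega) (by omega),
          hM.1 (k + 1) (j + 1) (by omega) (by omega) (by omega) (by omega)]
        linear_combination this)
      (by
        have := hM.ptolemy_right_s3 (k := k + 1) (by omega) (l := n) (by omega) le_rfl
        linear_combination this)
    simp only [ih, add_assoc, Nat.reduceAdd,
      hM.diag_eq_zero (i := k + 2) (by omega) (by omega),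
      hM.1 (k + 3) (k + 2) (by omega) (by omega) (by omega) (by omega)] at h
    apply mul_left_cancel₀ h0
    rw [Finset.prod_Icc_succ_top (by omega : 1 ≤ k + 1 + 1)]
    simp only [add_assoc, Nat.reduceAdd]
    rw [h]
    ring

end IsFriezeMatrix


/-- Theorem 5: the determinant of a frieze matrix `M` of size `n ≥ 2` is
`-(-2)^(n-2) * m 1 n * ∏_{i=1}^{n-1} m i (i+1)`. -/
theorem det_friezeMatrix {K : Type*} [Field K] [CharZero K]
    (n : ℕ) (hn : 2 ≤ n) (m : ℕ → ℕ → K) (hM : IsFriezeMatrix n m) :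
    (Matrix.of (fun i j : Fin n => m (i.1 + 1) (j.1 + 1))).det =
      -(-2 : K) ^ (n - 2) * m 1 n * ∏ i ∈ Finset.Icc 1 (n - 1), m i (i + 1) := by
  obtain ⟨k, rfl⟩ : ∃ k, n = k + 2 := ⟨n - 2, by omega⟩
  rw [Nat.add_sub_cancel, show k + 2 - 1 = k + 1 by omega, ← hM.det_borderedBlock k le_rfl]
  congr 1
  ext i j
  simp only [borderedBlock, Matrix.of_apply]
  split_ifs with h
  · rw [h]
  · rfl
end
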